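/- Fix n ≥ 2 and let Δ = {x ∈ ℝ^{n-1} : x_i > 0 for all i and Σ_i x_i < 1}, parametrizing the interior of the probability simplex via ρ(x) = (x_1, …, x_{n-1}, 1 − Σ_i x_i). Let M be an invertible n×n left-stochastic matrix such that Mρ(x) has strictly positive entries for almost every x ∈ Δ. Define the constants K := −∫_Δ Σ_{i=1}^{n} log ρ_i(x) dx and ⟨S⟩ := −∫_Δ Σ_{i=1}^{n} ρ_i(x) log ρ_i(x) dx (Lebesgue integrals over Δ ⊂ ℝ^{n-1}). Then ⟨S⟩ ≤ −∫_Δ Σ_{i=1}^{n} ρ_i(x) log (Mρ(x))_i dx ≤ K / |det M|; consequently the average relative entropy satisfies 0 ≤ ∫_Δ D(ρ(x) ‖ Mρ(x)) dx ≤ K/|det M| − ⟨S⟩, where D(ρ‖σ) = Σ_i ρ_i (log ρ_i − log σ_i). -/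

import Mathlib

open Matrix BigOperators MeasureTheory

/-- A left-stochastic matrix: nonnegative entries, each column summing to 1. -/
def IsLeftStochastic {n : ℕ} (M : Matrix (Fin n) (Fin n) ℝ) : Prop :=
  (∀ i j, 0 ≤ M i j) ∧ ∀ j, ∑ i, M i j = 1

/-- The interior of the probability simplex, parametrized by the first `n-1`
coordinates: `Δ = {x ∈ ℝ^{n-1} : x_i > 0, Σ_i x_i < 1}`. -/
def simplexInterior (n : ℕ) : Set (Fin (n - 1) → ℝ) :=
  {x | (∀ i, 0 < x i) ∧ ∑ i, x i < 1}

/-- The parametrization `ρ(x) = (x_1, …, x_{n-1}, 1 − Σ_i x_i)` of the interior of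
the probability simplex in `ℝⁿ`. -/
noncomputable def simplexPoint (n : ℕ) (x : Fin (n - 1) → ℝ) : Fin n → ℝ :=
  fun i => if h : (i : ℕ) < n - 1 then x ⟨i, h⟩ else 1 - ∑ j, x j


section Simplex

variable {m : ℕ}

@[simp]
theorem simplexPoint_castSucc (x : Fin m → ℝ) (i : Fin m) :
    simplexPoint (m + 1) x i.castSucc = x i := by
  simp [simplexPoint]

@[simp]
theorem simplexPoint_last (x : Fin m → ℝ) :
    simplexPoint (m + 1) x (Fin.last m) = 1 - ∑ j, x j := by
  simp [simplexPoint]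

theorem sum_simplexPoint (x : Fin m → ℝ) : ∑ i, simplexPoint (m + 1) x i = 1 := by
  simp [Fin.sum_univ_castSucc]

theorem simplexPoint_of_sum_eq_one {y : Fin (m + 1) → ℝ} (hy : ∑ i, y i = 1) :
    simplexPoint (m + 1) (fun i : Fin m => y i.castSucc) = y := by
  funext i
  refine Fin.lastCases ?_ (fun j => ?_) i
  · rw [Fin.sum_univ_castSucc] at hy
    rw [simplexPoint_last]
    linarith
  · simp

theorem mem_simplexInterior_iff {x : Fin m → ℝ} :
    x ∈ simplexInterior (m + 1) ↔ ∀ i, 0 < simplexPoint (m + 1) x i := by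
  rw [Fin.forall_fin_succ']
  simp [simplexInterior]

theorem simplexPoint_le_one {x : Fin m → ℝ} (hx : x ∈ simplexInterior (m + 1))
    (i : Fin (m + 1)) : simplexPoint (m + 1) x i ≤ 1 := by
  rw [← sum_simplexPoint x]
  exact Finset.single_le_sum (fun j _ => (mem_simplexInterior_iff.1 hx j).le) (Finset.mem_univ i)

theorem measurable_simplexPoint (i : Fin (m + 1)) :
    Measurable fun x : Fin m → ℝ => simplexPoint (m + 1) x i := by
  refine Fin.lastCases ?_ (fun j => ?_) i
  · simp only [simplexPoint_last]
    fun_prop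
  · simp only [simplexPoint_castSucc]
    fun_prop

theorem measurableSet_simplexInterior : MeasurableSet (simplexInterior (m + 1)) := by
  have : simplexInterior (m + 1) =
      ⋂ i, {x : Fin m → ℝ | 0 < simplexPoint (m + 1) x i} := by
    ext x
    simpa using mem_simplexInterior_iff (x := x)
  rw [this]
  exact MeasurableSet.iInter fun i => measurableSet_lt measurable_const (measurable_simplexPoint i)

/-- The map induced on the first `m` coordinates of the simplex by a matrix of size `m + 1`. -/
noncomputable def simplexMap (M : Matrix (Fin (m + 1)) (Fin (m + 1)) ℝ) (x : Fin m → ℝ) :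
    Fin m → ℝ :=
  fun i => (M *ᵥ simplexPoint (m + 1) x) i.castSucc

/-- The linear part of `simplexMap M`. -/
def simplexLinearPart (M : Matrix (Fin (m + 1)) (Fin (m + 1)) ℝ) : Matrix (Fin m) (Fin m) ℝ :=
  Matrix.of fun i j => M i.castSucc j.castSucc - M i.castSucc (Fin.last m)

theorem simplexMap_eq (M : Matrix (Fin (m + 1)) (Fin (m + 1)) ℝ) (x : Fin m → ℝ) :
    simplexMap M x = simplexLinearPart M *ᵥ x + fun i => M i.castSucc (Fin.last m) := by
  funext i
  simp only [simplexMap, simplexLinearPart, Matrix.mulVec, dotProduct, Fin.sum_univ_castSucc,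
    simplexPoint_castSucc, simplexPoint_last, Pi.add_apply, Matrix.of_apply, sub_mul,
    Finset.sum_sub_distrib, ← Finset.mul_sum]
  ring

theorem sum_mulVec_of_col_sum {M : Matrix (Fin (m + 1)) (Fin (m + 1)) ℝ}
    (hM : ∀ j, ∑ i, M i j = 1) (y : Fin (m + 1) → ℝ) : ∑ i, (M *ᵥ y) i = ∑ i, y i := by
  simp only [Matrix.mulVec, dotProduct]
  rw [Finset.sum_comm]
  simp [← Finset.sum_mul, hM]

theorem simplexPoint_simplexMap {M : Matrix (Fin (m + 1)) (Fin (m + 1)) ℝ}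
    (hM : ∀ j, ∑ i, M i j = 1) (x : Fin m → ℝ) :
    simplexPoint (m + 1) (simplexMap M x) = M *ᵥ simplexPoint (m + 1) x :=
  simplexPoint_of_sum_eq_one ((sum_mulVec_of_col_sum hM _).trans (sum_simplexPoint x))

theorem det_simplexLinearPart {M : Matrix (Fin (m + 1)) (Fin (m + 1)) ℝ}
    (hM : ∀ j, ∑ i, M i j = 1) : (simplexLinearPart M).det = M.det := by
  let e : Fin m ⊕ Fin 1 ≃ Fin (m + 1) := finSumFinEquiv
  let E : Matrix (Fin m ⊕ Fin 1) (Fin m ⊕ Fin 1) ℝ :=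
    Matrix.fromBlocks 1 0 (Matrix.of fun _ _ => 1) 1
  let b : Matrix (Fin m) (Fin 1) ℝ := Matrix.of fun i _ => M i.castSucc (Fin.last m)
  let N : Matrix (Fin m ⊕ Fin 1) (Fin m ⊕ Fin 1) ℝ :=
    Matrix.fromBlocks (simplexLinearPart M) b 0 1
  have hE : E.det = 1 := by simp [E]
  have hN : N.det = (simplexLinearPart M).det := by simp [N]
  have hl : ∀ k : Fin 1, e (Sum.inr k) = Fin.last m := fun k => by
    ext; simp [e]
  have hr : ∀ k : Fin m, e (Sum.inl k) = k.castSucc := fun k => by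
    ext; simp [e]
  have hEM : E * M.submatrix e e = N * E := by
    ext i j
    rcases i with i | i <;> rcases j with j | j <;>
      have h₁ := hM (Fin.last m) <;>
      (try have h₂ := hM j.castSucc) <;>
      simp_all [E, N, b, Matrix.mul_apply, Fin.sum_univ_castSucc, Matrix.one_apply,
        simplexLinearPart, Subsingleton.elim _ (0 : Fin 1)]
  have h := congrArg Matrix.det hEM
  rw [Matrix.det_mul, Matrix.det_mul, hE, hN, Matrix.det_submatrix_equiv_self] at h
  linarith

theorem mulVec_simplexPoint_pos {M : Matrix (Fin (m + 1)) (Fin (m + 1)) ℝ}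
    (hM : ∀ i j, 0 ≤ M i j) (hdet : M.det ≠ 0) {x : Fin m → ℝ}
    (hx : x ∈ simplexInterior (m + 1)) (i : Fin (m + 1)) :
    0 < (M *ᵥ simplexPoint (m + 1) x) i := by
  have hρ := mem_simplexInterior_iff.1 hx
  obtain ⟨j, hj⟩ : ∃ j, M i j ≠ 0 := by
    by_contra! h
    exact hdet (Matrix.det_eq_zero_of_row_eq_zero i h)
  exact Finset.sum_pos' (fun k _ => mul_nonneg (hM i k) (hρ k).le)
    ⟨j, Finset.mem_univ j, mul_pos ((hM i j).lt_of_ne' hj) (hρ j)⟩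

theorem mapsTo_simplexMap {M : Matrix (Fin (m + 1)) (Fin (m + 1)) ℝ} (hM : IsLeftStochastic M)
    (hdet : M.det ≠ 0) :
    Set.MapsTo (simplexMap M) (simplexInterior (m + 1)) (simplexInterior (m + 1)) := fun x hx => by
  refine mem_simplexInterior_iff.2 ?_
  rw [simplexPoint_simplexMap hM.2]
  exact mulVec_simplexPoint_pos hM.1 hdet hx

theorem hasFDerivAt_simplexMap (M : Matrix (Fin (m + 1)) (Fin (m + 1)) ℝ) (x : Fin m → ℝ) :
    HasFDerivAt (simplexMap M) (simplexLinearPart M).toLin'.toContinuousLinearMap x := by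
  have h : simplexMap M = fun x => (simplexLinearPart M).toLin'.toContinuousLinearMap x +
      fun i => M i.castSucc (Fin.last m) := by
    funext x
    simp [simplexMap_eq]
  rw [h]
  exact (ContinuousLinearMap.hasFDerivAt _).add_const _

theorem det_fderiv_simplexMap {M : Matrix (Fin (m + 1)) (Fin (m + 1)) ℝ}
    (hM : ∀ j, ∑ i, M i j = 1) :
    ((simplexLinearPart M).toLin'.toContinuousLinearMap).det = M.det := by
  rw [← det_simplexLinearPart hM, LinearMap.det_toContinuousLinearMap, LinearMap.det_toLin']

theorem simplexMap_injective {M : Matrix (Fin (m + 1)) (Fin (m + 1)) ℝ}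
    (hM : ∀ j, ∑ i, M i j = 1) (hdet : M.det ≠ 0) : Function.Injective (simplexMap M) := by
  intro x y h
  have h' := congrArg (simplexPoint (m + 1)) h
  rw [simplexPoint_simplexMap hM, simplexPoint_simplexMap hM] at h'
  have h'' := Matrix.mulVec_injective_of_isUnit ((Matrix.isUnit_iff_isUnit_det M).2 hdet.isUnit) h'
  funext i
  simpa using congrFun h'' i.castSucc

theorem integrableOn_comp_simplexMap {M : Matrix (Fin (m + 1)) (Fin (m + 1)) ℝ}
    (hM : IsLeftStochastic M) (hdet : M.det ≠ 0) {g : (Fin m → ℝ) → ℝ}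
    (hg : IntegrableOn g (simplexInterior (m + 1))) :
    IntegrableOn (fun x => g (simplexMap M x)) (simplexInterior (m + 1)) := by
  have h := (integrableOn_image_iff_integrableOn_abs_det_fderiv_smul volume
    measurableSet_simplexInterior (fun x _ => (hasFDerivAt_simplexMap M x).hasFDerivWithinAt)
    (simplexMap_injective hM.2 hdet).injOn g).1
    (hg.mono_set (mapsTo_simplexMap hM hdet).image_subset)
  rw [det_fderiv_simplexMap hM.2] at h
  exact (integrable_smul_iff (abs_ne_zero.2 hdet) _).1 h

theorem setIntegral_comp_simplexMap_le {M : Matrix (Fin (m + 1)) (Fin (m + 1)) ℝ}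
    (hM : IsLeftStochastic M) (hdet : M.det ≠ 0) {g : (Fin m → ℝ) → ℝ}
    (hg : IntegrableOn g (simplexInterior (m + 1)))
    (hg₀ : ∀ x ∈ simplexInterior (m + 1), 0 ≤ g x) :
    ∫ x in simplexInterior (m + 1), g (simplexMap M x) ≤
      (∫ x in simplexInterior (m + 1), g x) / |M.det| := by
  have h := integral_image_eq_integral_abs_det_fderiv_smul volume
    measurableSet_simplexInterior (fun x _ => (hasFDerivAt_simplexMap M x).hasFDerivWithinAt)
    (simplexMap_injective hM.2 hdet).injOn g
  rw [det_fderiv_simplexMap hM.2, integral_smul, smul_eq_mul] at h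
  rw [le_div_iff₀' (abs_pos.2 hdet), ← h]
  exact setIntegral_mono_set hg
    ((ae_restrict_iff' measurableSet_simplexInterior).2 (Filter.Eventually.of_forall hg₀))
    (mapsTo_simplexMap hM hdet).image_subset.eventuallyLE

theorem integrableOn_log_coord (i : Fin m) :
    IntegrableOn (fun x : Fin m → ℝ => Real.log (x i)) (simplexInterior (m + 1)) := by
  have hlog : IntegrableOn Real.log (Set.Ioc 0 1) :=
    (intervalIntegrable_iff_integrableOn_Ioc_of_le zero_le_one).1
      intervalIntegral.intervalIntegrable_log'
  have hcube : IntegrableOn (fun x : Fin m → ℝ => Real.log (x i))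
      (Set.univ.pi fun _ => Set.Ioc 0 1) := by
    rw [IntegrableOn, volume_pi, Measure.restrict_pi_pi]
    exact integrable_comp_eval (μ := fun _ : Fin m => volume.restrict (Set.Ioc (0 : ℝ) 1)) hlog
  refine hcube.mono_set fun x hx j _ => ⟨hx.1 j, ?_⟩
  simpa using simplexPoint_le_one hx j.castSucc

theorem isLeftStochastic_permMatrix (σ : Equiv.Perm (Fin (m + 1))) :
    IsLeftStochastic (σ.permMatrix ℝ) := by
  refine ⟨fun i j => ?_, fun j => ?_⟩
  · rw [Equiv.Perm.permMatrix, PEquiv.toMatrix_apply]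
    split_ifs <;> norm_num
  · simp [Equiv.Perm.permMatrix, PEquiv.toMatrix_apply, ← Equiv.eq_symm_apply]

theorem integrableOn_log_simplexPoint (hm : 0 < m) (i : Fin (m + 1)) :
    IntegrableOn (fun x : Fin m → ℝ => Real.log (simplexPoint (m + 1) x i))
      (simplexInterior (m + 1)) := by
  let k : Fin m := ⟨0, hm⟩
  let σ : Equiv.Perm (Fin (m + 1)) := Equiv.swap k.castSucc i
  have h := integrableOn_comp_simplexMap (isLeftStochastic_permMatrix σ)
    (by rw [Matrix.det_permutation]; exact_mod_cast (Equiv.Perm.sign σ).ne_zero)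
    (integrableOn_log_coord k)
  simpa [simplexMap, Matrix.permMatrix_mulVec, σ] using h

end Simplex

theorem sum_mul_log_sub_log_nonneg {ι : Type*} [Fintype ι] {p q : ι → ℝ} (hp : ∀ i, 0 < p i)
    (hq : ∀ i, 0 < q i) (h : ∑ i, q i ≤ ∑ i, p i) :
    0 ≤ ∑ i, p i * (Real.log (p i) - Real.log (q i)) := by
  have key : ∀ i, p i - q i ≤ p i * (Real.log (p i) - Real.log (q i)) := fun i => by
    have h₁ := Real.log_le_sub_one_of_pos (div_pos (hq i) (hp i))
    rw [Real.log_div (hq i).ne' (hp i).ne'] at h₁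
    have h₂ := mul_le_mul_of_nonneg_left h₁ (hp i).le
    rw [mul_sub (p i) (q i / p i), mul_div_cancel₀ _ (hp i).ne'] at h₂
    linarith
  calc 0 ≤ ∑ i, (p i - q i) := by rw [Finset.sum_sub_distrib]; linarith
    _ ≤ _ := Finset.sum_le_sum fun i _ => key i

theorem average_relative_entropy_bound {n : ℕ} (hn : 2 ≤ n)
    (M : Matrix (Fin n) (Fin n) ℝ) (hM : IsLeftStochastic M)
    (hMinv : IsUnit M.det)
    (hpos : ∀ᵐ x ∂(volume.restrict (simplexInterior n)),
      ∀ i, 0 < M.mulVec (simplexPoint n x) i) :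
    (-∫ x in simplexInterior n, ∑ i, simplexPoint n x i * Real.log (simplexPoint n x i))
      ≤ -∫ x in simplexInterior n,
          ∑ i, simplexPoint n x i * Real.log (M.mulVec (simplexPoint n x) i) ∧
    (-∫ x in simplexInterior n,
        ∑ i, simplexPoint n x i * Real.log (M.mulVec (simplexPoint n x) i))
      ≤ (-∫ x in simplexInterior n, ∑ i, Real.log (simplexPoint n x i)) / |M.det| ∧
    0 ≤ ∫ x in simplexInterior n,
        ∑ i, simplexPoint n x i *
          (Real.log (simplexPoint n x i) - Real.log (M.mulVec (simplexPoint n x) i)) ∧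
    (∫ x in simplexInterior n,
        ∑ i, simplexPoint n x i *
          (Real.log (simplexPoint n x i) - Real.log (M.mulVec (simplexPoint n x) i)))
      ≤ (-∫ x in simplexInterior n, ∑ i, Real.log (simplexPoint n x i)) / |M.det|
        - (-∫ x in simplexInterior n,
            ∑ i, simplexPoint n x i * Real.log (simplexPoint n x i)) := by
  obtain ⟨m, rfl⟩ : ∃ m, n = m + 1 := ⟨n - 1, by omega⟩
  have hdet : M.det ≠ 0 := hMinv.ne_zero
  have hlog := integrableOn_log_simplexPoint (m := m) (by omega)
  have hlogM : ∀ i, IntegrableOn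
      (fun x : Fin m → ℝ => Real.log ((M *ᵥ simplexPoint (m + 1) x) i))
      (simplexInterior (m + 1)) := fun i => by
    simpa only [simplexPoint_simplexMap hM.2] using
      integrableOn_comp_simplexMap hM hdet (hlog i)
  have hmul : ∀ (i : Fin (m + 1)) {f : (Fin m → ℝ) → ℝ},
      IntegrableOn f (simplexInterior (m + 1)) →
      IntegrableOn (fun x => simplexPoint (m + 1) x i * f x) (simplexInterior (m + 1)) :=
    fun i f hf => by
      refine Integrable.bdd_mul hf (c := 1) (measurable_simplexPoint i).aestronglyMeasurable ?_
      filter_upwards [ae_restrict_mem measurableSet_simplexInterior] with x hx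
      rw [Real.norm_of_nonneg (mem_simplexInterior_iff.1 hx i).le]
      exact simplexPoint_le_one hx i
  have hS : IntegrableOn (fun x : Fin m → ℝ => ∑ i, simplexPoint (m + 1) x i *
      Real.log (simplexPoint (m + 1) x i)) (simplexInterior (m + 1)) :=
    integrable_finsetSum _ fun i _ => hmul i (hlog i)
  have hT : IntegrableOn (fun x : Fin m → ℝ => ∑ i, simplexPoint (m + 1) x i *
      Real.log ((M *ᵥ simplexPoint (m + 1) x) i)) (simplexInterior (m + 1)) :=
    integrable_finsetSum _ fun i _ => hmul i (hlogM i)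
  have hD : ∫ x in simplexInterior (m + 1), ∑ i, simplexPoint (m + 1) x i *
        (Real.log (simplexPoint (m + 1) x i) - Real.log ((M *ᵥ simplexPoint (m + 1) x) i)) =
      (∫ x in simplexInterior (m + 1), ∑ i, simplexPoint (m + 1) x i *
        Real.log (simplexPoint (m + 1) x i)) -
      ∫ x in simplexInterior (m + 1), ∑ i, simplexPoint (m + 1) x i *
        Real.log ((M *ᵥ simplexPoint (m + 1) x) i) := by
    refine Eq.trans ?_ (integral_sub hS hT)
    simp only [mul_sub, Finset.sum_sub_distrib]
  have hD₀ : 0 ≤ ∫ x in simplexInterior (m + 1), ∑ i, simplexPoint (m + 1) x i *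
      (Real.log (simplexPoint (m + 1) x i) - Real.log ((M *ᵥ simplexPoint (m + 1) x) i)) := by
    refine setIntegral_nonneg measurableSet_simplexInterior fun x hx => ?_
    exact sum_mul_log_sub_log_nonneg (mem_simplexInterior_iff.1 hx)
      (mulVec_simplexPoint_pos hM.1 hdet hx) (sum_mulVec_of_col_sum hM.2 _).le
  have hneg : ∀ x ∈ simplexInterior (m + 1), ∀ i, Real.log (simplexPoint (m + 1) x i) ≤ 0 :=
    fun x hx i => Real.log_nonpos (mem_simplexInterior_iff.1 hx i).le (simplexPoint_le_one hx i)
  have hK : IntegrableOn (fun x : Fin m → ℝ => -∑ i, Real.log (simplexPoint (m + 1) x i))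
      (simplexInterior (m + 1)) :=
    (integrable_finsetSum _ fun i _ => hlog i).neg
  have hup : (-∫ x in simplexInterior (m + 1), ∑ i, simplexPoint (m + 1) x i *
        Real.log ((M *ᵥ simplexPoint (m + 1) x) i)) ≤
      (-∫ x in simplexInterior (m + 1), ∑ i, Real.log (simplexPoint (m + 1) x i)) / |M.det| := by
    rw [← integral_neg, ← integral_neg]
    refine le_trans ?_ (setIntegral_comp_simplexMap_le hM hdet hK fun x hx =>
      neg_nonneg.2 (Finset.sum_nonpos fun i _ => hneg x hx i))
    refine setIntegral_mono_on hT.neg (integrableOn_comp_simplexMap hM hdet hK)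
      measurableSet_simplexInterior fun x hx => neg_le_neg (Finset.sum_le_sum fun i _ => ?_)
    have h₁ := hneg _ (mapsTo_simplexMap hM hdet hx) i
    rw [simplexPoint_simplexMap hM.2] at h₁ ⊢
    nlinarith [simplexPoint_le_one hx i]
  refine ⟨?_, hup, hD₀, ?_⟩
  · have := hD ▸ hD₀
    linarith
  · refine hD.trans_le ?_
    linarith
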